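/- Let Z₁,…,Z_r be pairwise disjoint finite sets in a real inner product space, each of size k, let S = ⋃ᵢ Zᵢ and D = maxᵢ diam Zᵢ. Then there exists a point q and a partition S₁,…,S_k of S with |Sᵢ ∩ Zⱼ| = 1 for all i ∈ [k], j ∈ [r], such that dist(q, conv Sᵢ) ≤ (√2/(1 − 1/√2)) · r^{−1/2} · D for every i ∈ [k]. -/

import Mathlib

/-- In every family of `J` colour classes indexed by `ι`, each of diameter at most `D`, the points
can be regrouped into rainbow sets whose sums are within `B` of the sum of the colour centroids. -/
def HasBalancedRegrouping (X J ι : Type*) [NormedAddCommGroup X] [InnerProductSpace ℝ X]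
    [Fintype J] [Fintype ι] (D B : ℝ) : Prop :=
  ∀ x : J → ι → X, (∀ j a b, ‖x j a - x j b‖ ≤ D) →
    ∃ σ : J → ι → ι, (∀ j, Function.Injective (σ j)) ∧
      ∀ i, ‖∑ j, x j (σ j i) - (Fintype.card ι : ℝ)⁻¹ • ∑ j, ∑ a, x j a‖ ≤ B

section

variable {X J ι κ : Type*} [NormedAddCommGroup X] [InnerProductSpace ℝ X]
  [Fintype ι] [Fintype κ]

/-- One vector can be chosen from each of finitely many families with sum zero so that the choices
satisfy the upper bound known for sums of orthogonal vectors. -/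
theorem exists_norm_sum_sq_le [Nonempty κ] (s : Finset J) (v : J → κ → X)
    (hv : ∀ j, ∑ a, v j a = 0) {D : ℝ} (hD : ∀ j a, ‖v j a‖ ≤ D) :
    ∃ z : J → κ, ‖∑ j ∈ s, v j (z j)‖ ^ 2 ≤ s.card * D ^ 2 := by
  classical
  induction s using Finset.induction_on with
  | empty => exact ⟨fun _ => Classical.arbitrary κ, by simp⟩
  | insert j s hj ih =>
    obtain ⟨z, hz⟩ := ih
    obtain ⟨a, -, ha⟩ : ∃ a ∈ (Finset.univ : Finset κ),
        inner ℝ (v j a) (∑ l ∈ s, v l (z l)) ≤ (0 : ℝ) := by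
      apply Finset.exists_le_of_sum_le Finset.univ_nonempty
      rw [← sum_inner, hv]
      simp
    refine ⟨Function.update z j a, ?_⟩
    have hs : ∑ l ∈ s, v l (Function.update z j a l) = ∑ l ∈ s, v l (z l) := by
      refine Finset.sum_congr rfl fun l hl => ?_
      rw [Function.update_of_ne (ne_of_mem_of_not_mem hl hj)]
    rw [Finset.sum_insert hj, hs, Function.update_self, norm_add_sq_real,
      Finset.card_insert_of_notMem hj]
    have := pow_le_pow_left₀ (norm_nonneg _) (hD j a) 2
    push_cast
    linarith

variable [Fintype J]

theorem exists_norm_sum_le [Nonempty κ] (v : J → κ → X)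
    (hv : ∀ j, ∑ a, v j a = 0) {D : ℝ} (hD₀ : 0 ≤ D) (hD : ∀ j a, ‖v j a‖ ≤ D) :
    ∃ z : J → κ, ‖∑ j, v j (z j)‖ ≤ √(Fintype.card J) * D := by
  obtain ⟨z, hz⟩ := exists_norm_sum_sq_le Finset.univ v hv hD
  refine ⟨z, abs_le_of_sq_le_sq' ?_ (by positivity) |>.2⟩
  rwa [mul_pow, Real.sq_sqrt (by positivity), ← Finset.card_univ]

/-- Every point of a finite family is within `D` of the centroid if the diameter is at most `D`. -/
theorem norm_sub_centroid_le [Nonempty ι] (x : ι → X) {D : ℝ} (hD : ∀ a b, ‖x a - x b‖ ≤ D)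
    (a : ι) : ‖x a - (Fintype.card ι : ℝ)⁻¹ • ∑ b, x b‖ ≤ D := by
  have hc : (0 : ℝ) < Fintype.card ι := by exact_mod_cast Fintype.card_pos
  have h : x a - (Fintype.card ι : ℝ)⁻¹ • ∑ b, x b =
      (Fintype.card ι : ℝ)⁻¹ • ∑ b, (x a - x b) := by
    rw [Finset.sum_sub_distrib, smul_sub, Finset.sum_const, Finset.card_univ,
      ← Nat.cast_smul_eq_nsmul ℝ, smul_smul, inv_mul_cancel₀ hc.ne', one_smul]
  rw [h, norm_smul, Real.norm_of_nonneg (by positivity), inv_mul_le_iff₀ hc]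
  calc ‖∑ b, (x a - x b)‖ ≤ ∑ _b : ι, D := norm_sum_le_of_le _ fun b _ => hD a b
    _ = _ := by simp

namespace HasBalancedRegrouping

variable {D B B' : ℝ}

theorem mono (h : HasBalancedRegrouping X J ι D B) (hB : B ≤ B') :
    HasBalancedRegrouping X J ι D B' := fun x hx =>
  let ⟨σ, hσ, hb⟩ := h x hx
  ⟨σ, hσ, fun i => (hb i).trans hB⟩

theorem congr (e : ι ≃ κ) (h : HasBalancedRegrouping X J ι D B) :
    HasBalancedRegrouping X J κ D B := by
  intro x hx
  obtain ⟨σ, hσ, hb⟩ := h (fun j i => x j (e i)) fun j a b => hx j _ _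
  refine ⟨fun j i => e (σ j (e.symm i)),
    fun j => e.injective.comp ((hσ j).comp e.symm.injective), fun i => ?_⟩
  have := hb (e.symm i)
  simp only [fun j => Equiv.sum_comp e (x j)] at this
  rwa [Fintype.card_congr e] at this

theorem of_unique [Unique ι] : HasBalancedRegrouping X J ι D 0 := by
  intro x _
  exact ⟨fun _ => id, fun _ => Function.injective_id, fun i => by
    simp [Unique.eq_default i]⟩

theorem prod_bool [Nonempty ι] (hD : 0 ≤ D) (h : HasBalancedRegrouping X J ι D B) :
    HasBalancedRegrouping X J (ι × Bool) D
      (B + √(Fintype.card J) * D / (2 * √(Fintype.card ι))) := by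
  intro x hx
  have hc : (0 : ℝ) < Fintype.card ι := by exact_mod_cast Fintype.card_pos
  obtain ⟨ε, hε⟩ := exists_norm_sum_le (J := J × ι) (κ := Bool)
    (fun p b => x p.1 (p.2, b) - x p.1 (p.2, !b)) (by intro p; simp [add_comm]) hD
    (fun p b => hx _ _ _)
  have key (b : Bool) : ‖(Fintype.card ι : ℝ)⁻¹ • ∑ j, ∑ a, x j (a, xor b (ε (j, a))) -
      (Fintype.card (ι × Bool) : ℝ)⁻¹ • ∑ j, ∑ a, x j a‖ ≤
      √(Fintype.card J) * D / (2 * √(Fintype.card ι)) := by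
    have e : (Fintype.card ι : ℝ)⁻¹ • ∑ j, ∑ a, x j (a, xor b (ε (j, a))) -
        (Fintype.card (ι × Bool) : ℝ)⁻¹ • ∑ j, ∑ a, x j a =
        ((2 * Fintype.card ι : ℝ)⁻¹ * (if b then -1 else 1)) • ∑ p : J × ι,
          (x p.1 (p.2, ε p) - x p.1 (p.2, !(ε p))) := by
      have h2 : (Fintype.card ι : ℝ)⁻¹ = (2 * Fintype.card ι : ℝ)⁻¹ * 2 := by
        field_simp
      have h3 : (Fintype.card (ι × Bool) : ℝ)⁻¹ = (2 * Fintype.card ι : ℝ)⁻¹ := by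
        simp [mul_comm]
      rw [h3, h2, mul_smul, mul_smul, ← smul_sub]
      congr 1
      simp only [Fintype.sum_prod_type, Finset.smul_sum, ← Finset.sum_sub_distrib]
      refine Finset.sum_congr rfl fun j _ => Finset.sum_congr rfl fun a _ => ?_
      rw [Fintype.sum_bool, two_smul]
      cases b <;> cases ε (j, a) <;> simp
    rw [e, norm_smul, norm_mul, show ‖(if b then -1 else 1 : ℝ)‖ = 1 by split <;> simp, mul_one,
      Real.norm_of_nonneg (by positivity)]
    calc _ ≤ (2 * Fintype.card ι : ℝ)⁻¹ * (√(Fintype.card (J × ι)) * D) := by gcongr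
      _ = _ := by
        rw [Fintype.card_prod, Nat.cast_mul, Real.sqrt_mul (by positivity)]
        have hs : √(Fintype.card ι : ℝ) ≠ 0 := by positivity
        field_simp
        rw [Real.sq_sqrt hc.le]
        ring
  choose σ hσ hb using fun b : Bool =>
    h (fun j a => x j (a, xor b (ε (j, a)))) fun j _ _ => hx j _ _
  refine ⟨fun j p => (σ p.2 j p.1, xor p.2 (ε (j, σ p.2 j p.1))), ?_, fun p => ?_⟩
  · rintro j ⟨i, b⟩ ⟨i', b'⟩ hp
    simp only [Prod.mk.injEq] at hp
    obtain ⟨h1, h2⟩ := hp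
    rw [h1] at h2
    obtain rfl : b = b' := by simpa using h2
    rw [hσ b j h1]
  · exact (norm_sub_le_norm_sub_add_norm_sub _ _ _).trans (add_le_add (hb p.2 p.1) (key p.2))

theorem option [Nonempty ι] (hD : 0 ≤ D) (h : HasBalancedRegrouping X J ι D B) :
    HasBalancedRegrouping X J (Option ι) D
      (max (√(Fintype.card J) * D) (B + √(Fintype.card J) * D / Fintype.card ι)) := by
  classical
  intro x hx
  have hc : (0 : ℝ) < Fintype.card ι := by exact_mod_cast Fintype.card_pos
  set c : J → X := fun j => (Fintype.card (Option ι) : ℝ)⁻¹ • ∑ a, x j a with hc_def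
  have hcsum (j : J) : ∑ a, x j a = (Fintype.card ι + 1 : ℝ) • c j := by
    rw [hc_def, smul_smul, Fintype.card_option, Nat.cast_add, Nat.cast_one,
      mul_inv_cancel₀ (by positivity), one_smul]
  obtain ⟨z, hz⟩ := exists_norm_sum_le (fun j a => x j a - c j) (by
      intro j
      rw [Finset.sum_sub_distrib, hcsum, Finset.sum_const, Finset.card_univ,
        ← Nat.cast_smul_eq_nsmul ℝ, Fintype.card_option]
      simp) hD fun j a => norm_sub_centroid_le (x j) (hx j) a
  obtain ⟨σ, hσ, hb⟩ := h (fun j a => x j (Equiv.swap none (z j) (some a))) fun j _ _ => hx j _ _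
  have hrest (j : J) : ∑ a, x j (Equiv.swap none (z j) (some a)) =
      (Fintype.card ι + 1 : ℝ) • c j - x j (z j) := by
    rw [← hcsum, ← Equiv.sum_comp (Equiv.swap none (z j)), Fintype.sum_option,
      Equiv.swap_apply_left]
    abel
  have key : ‖(Fintype.card ι : ℝ)⁻¹ • ∑ j, ∑ a, x j (Equiv.swap none (z j) (some a)) -
      ∑ j, c j‖ ≤ √(Fintype.card J) * D / Fintype.card ι := by
    have e : (Fintype.card ι : ℝ)⁻¹ • ∑ j, ∑ a, x j (Equiv.swap none (z j) (some a)) -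
        ∑ j, c j = -((Fintype.card ι : ℝ)⁻¹ • ∑ j, (x j (z j) - c j)) := by
      simp only [hrest, Finset.smul_sum, ← Finset.sum_sub_distrib, ← Finset.sum_neg_distrib]
      refine Finset.sum_congr rfl fun j _ => ?_
      match_scalars
      · field_simp
        ring
      · field_simp
    rw [e, norm_neg, norm_smul, Real.norm_of_nonneg (by positivity), div_eq_inv_mul]
    gcongr
  refine ⟨fun j => Equiv.swap none (z j) ∘ Option.map (σ j),
    fun j => (Equiv.injective _).comp (Option.map_injective (hσ j)), ?_⟩
  rintro (_ | i)
  · refine le_max_of_le_left ?_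
    simpa [Finset.smul_sum, hc_def] using hz
  · refine le_max_of_le_right ?_
    refine (norm_sub_le_norm_sub_add_norm_sub _ _ _).trans (add_le_add (hb i) ?_)
    rwa [Finset.smul_sum (s := Finset.univ) (f := fun j => ∑ a : Option ι, x j a)]

theorem fin (hD : 0 ≤ D) (n : ℕ) (hn : 0 < n) :
    HasBalancedRegrouping X J (Fin n) D
      (√2 / (1 - 1 / √2) * (1 - 1 / √n) * (√(Fintype.card J) * D)) := by
  set M := √(Fintype.card J) * D with hM
  have hM₀ : 0 ≤ M := by positivity
  set C := √2 / (1 - 1 / √2) with hC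
  have h1 : 1 < √2 := by rw [Real.lt_sqrt] <;> norm_num
  have hlt : 1 / √2 < 1 := by rw [div_lt_one (by positivity)]; exact h1
  have hC₀ : 0 ≤ C := div_nonneg (by positivity) (by linarith)
  have hC₁ : C * (1 - 1 / √2) = √2 := div_mul_cancel₀ _ (by linarith)
  have hstep (h : ℕ) (hh : 0 < h) :
      C * (1 - 1 / √h) * M + 1 / √h * M ≤ C * (1 - 1 / √(2 * h : ℕ)) * M := by
    rw [Nat.cast_mul, Nat.cast_ofNat, Real.sqrt_mul (by norm_num), ← add_mul]
    refine mul_le_mul_of_nonneg_right ?_ hM₀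
    have : C * (1 - 1 / (√2 * √h)) - C * (1 - 1 / √h) = √2 * (1 / √h) := by
      linear_combination (1 / √(h : ℝ)) * hC₁
    have : 1 / √h ≤ √2 * (1 / √(h : ℝ)) := le_mul_of_one_le_left (by positivity) h1.le
    linarith
  have hmono {m n : ℕ} (hm : 0 < m) (hmn : m ≤ n) :
      C * (1 - 1 / √m) * M ≤ C * (1 - 1 / √n) * M := by
    gcongr
  induction n using Nat.strong_induction_on with
  | _ n ih =>
  obtain ⟨h, rfl | rfl⟩ := Nat.even_or_odd' n
  · have hh : 0 < h := by omega
    have : Nonempty (Fin h) := ⟨⟨0, hh⟩⟩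
    have e : Fin h × Bool ≃ Fin (2 * h) := Fintype.equivOfCardEq (by simp [mul_comm])
    refine (((ih h (by omega) hh).prod_bool hD).congr e).mono ?_
    rw [Fintype.card_fin]
    have : M / (2 * √h) ≤ 1 / √h * M := by
      rw [one_div_mul_eq_div]
      gcongr
      linarith [Real.sqrt_nonneg (h : ℝ)]
    linarith [hstep h hh]
  · rcases Nat.eq_zero_or_pos h with rfl | hh
    · exact (of_unique (ι := Fin 1)).mono (by simp)
    have : Nonempty (Fin h) := ⟨⟨0, hh⟩⟩
    have e : Option (Fin h × Bool) ≃ Fin (2 * h + 1) :=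
      Fintype.equivOfCardEq (by simp [mul_comm])
    refine ((((ih h (by omega) hh).prod_bool hD).option hD).congr e).mono ?_
    refine max_le ?_
      ((?_ : _ ≤ C * (1 - 1 / √(2 * h : ℕ)) * M).trans (hmono (by omega) (by omega)))
    · calc M ≤ √2 * M := le_mul_of_one_le_left hM₀ h1.le
        _ = C * (1 - 1 / √(2 : ℕ)) * M := by rw [← hC₁, Nat.cast_ofNat]
        _ ≤ _ := hmono (by omega) (by omega)
    · have hs : √(h : ℝ) ≤ h :=
        Real.sqrt_le_self_iff.2 (by exact_mod_cast Or.inr hh)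
      have : M / (h * 2) ≤ M / (2 * √h) := by
        rw [mul_comm (h : ℝ)]
        gcongr
      have : M / (2 * √h) + M / (2 * √h) = 1 / √h * M := by
        field_simp
        ring
      simp only [Fintype.card_prod, Fintype.card_fin, Fintype.card_bool, Nat.cast_mul,
        Nat.cast_ofNat, ← hM]
      have := hstep h hh
      push_cast at this
      linarith

end HasBalancedRegrouping

end


/-- No-dimension colorful Tverberg theorem in a real inner product space:
for pairwise disjoint color classes `Z₁,…,Z_r` of size `k` with union `S` and
`D ≥ maxᵢ diam Zᵢ`, there is a point `q` and a partition `S₁,…,S_k` of `S` into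
rainbow sets (one point of each color) with
`dist(q, conv Sᵢ) ≤ (√2/(1 − 1/√2)) · r^{−1/2} · D` for all `i`. -/
theorem nodim_colorful_tverberg {X : Type*} [DecidableEq X] [NormedAddCommGroup X] [InnerProductSpace ℝ X]
    (r k : ℕ) (hr : 0 < r) (hk : 0 < k) (Z : Fin r → Finset X)
    (hdisj : ∀ i j, i ≠ j → Disjoint (Z i) (Z j)) (hcard : ∀ i, (Z i).card = k)
    (S : Finset X) (hS : S = Finset.univ.biUnion Z)
    (D : ℝ) (hD : ∀ i, Metric.diam (Z i : Set X) ≤ D) :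
    ∃ (q : X) (T : Fin k → Finset X),
      (∀ i j, i ≠ j → Disjoint (T i) (T j)) ∧
      Finset.univ.biUnion T = S ∧
      (∀ i j, (T i ∩ Z j).card = 1) ∧
      ∀ i, Metric.infDist q (convexHull ℝ (T i : Set X)) ≤
        Real.sqrt 2 / (1 - 1 / Real.sqrt 2) / Real.sqrt r * D := by
  classical
  have hD₀ : 0 ≤ D := Metric.diam_nonneg.trans (hD ⟨0, hr⟩)
  have hr₀ : (0 : ℝ) < r := by exact_mod_cast hr
  let e (j : Fin r) : Fin k ≃ Z j := (Fintype.equivFinOfCardEq (by simp [hcard j])).symm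
  let x (j : Fin r) (i : Fin k) : X := e j i
  have hxZ (j i) : x j i ∈ Z j := (e j i).2
  have hxi (j) : Function.Injective (x j) := Subtype.val_injective.comp (e j).injective
  obtain ⟨σ, hσ, hb⟩ := HasBalancedRegrouping.fin hD₀ k hk x fun j a b => by
    rw [← dist_eq_norm]
    exact (Metric.dist_le_diam_of_mem (Z j).finite_toSet.isBounded (hxZ j a) (hxZ j b)).trans
      (hD j)
  have hcolor {j j' : Fin r} {p : X} (h : p ∈ Z j) (h' : p ∈ Z j') : j = j' := by
    by_contra hne
    exact Finset.disjoint_left.1 (hdisj j j' hne) h h'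
  refine ⟨(r : ℝ)⁻¹ • (Fintype.card (Fin k) : ℝ)⁻¹ • ∑ j, ∑ a, x j a,
    fun i => Finset.univ.image fun j => x j (σ j i), ?_, ?_, ?_, ?_⟩
  · intro i i' hne
    rw [Finset.disjoint_left]
    intro p hp hp'
    simp only [Finset.mem_image, Finset.mem_univ, true_and] at hp hp'
    obtain ⟨j, rfl⟩ := hp
    obtain ⟨j', hj'⟩ := hp'
    obtain rfl : j' = j := hcolor (hj' ▸ hxZ j' _) (hxZ j _)
    exact hne (hσ _ (hxi _ hj')).symm
  · subst hS
    ext p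
    simp only [Finset.mem_biUnion, Finset.mem_image, Finset.mem_univ, true_and]
    constructor
    · rintro ⟨i, j, rfl⟩
      exact ⟨j, hxZ j _⟩
    · rintro ⟨j, hp⟩
      obtain ⟨i, hi⟩ := (Finite.surjective_of_injective (hσ j)) ((e j).symm ⟨p, hp⟩)
      exact ⟨i, j, by simp [x, hi]⟩
  · intro i j
    rw [Finset.card_eq_one]
    refine ⟨x j (σ j i), ?_⟩
    ext p
    simp only [Finset.mem_inter, Finset.mem_image, Finset.mem_univ, true_and,
      Finset.mem_singleton]
    constructor
    · rintro ⟨⟨j', rfl⟩, hp⟩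
      obtain rfl := hcolor (hxZ j' _) hp
      rfl
    · rintro rfl
      exact ⟨⟨j, rfl⟩, hxZ j _⟩
  · intro i
    have hmem : (r : ℝ)⁻¹ • ∑ j, x j (σ j i) ∈
        convexHull ℝ ((Finset.univ.image fun j => x j (σ j i) : Finset X) : Set X) := by
      rw [Finset.smul_sum]
      refine (convex_convexHull ℝ _).sum_mem (fun _ _ => by positivity) (by simp [hr₀.ne'])
        fun j _ => subset_convexHull ℝ _ (by simp)
    refine (Metric.infDist_le_dist_of_mem hmem).trans ?_
    rw [dist_comm, dist_eq_norm, ← smul_sub, norm_smul, Real.norm_of_nonneg (by positivity),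
      inv_mul_le_iff₀ hr₀]
    refine (hb i).trans ?_
    have h1 : 1 < √2 := by rw [Real.lt_sqrt] <;> norm_num
    have hlt : 1 / √2 < 1 := by rw [div_lt_one (by positivity)]; exact h1
    have hC : 0 ≤ √2 / (1 - 1 / √2) := div_nonneg (by positivity) (by linarith)
    have hk' : 1 - 1 / √(k : ℝ) ≤ 1 := sub_le_self _ (by positivity)
    calc _ ≤ √2 / (1 - 1 / √2) * 1 * (√(Fintype.card (Fin r)) * D) := by gcongr
      _ = _ := by
        rw [Fintype.card_fin]
        nth_rewrite 2 [← Real.mul_self_sqrt hr₀.le]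
        have : √(r : ℝ) ≠ 0 := by positivity
        generalize √2 / (1 - 1 / √2) = C
        field_simp
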